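/- arXiv:2203.03419 — 3 statements merged into one kernel-verified Lean document; each statement's English description precedes it below -/
import Mathlib

section
/- Let n ≥ 5 and let I' be the set of all rows of the n−2 row-blocks [1,n−1], [2,n−1], …, [n−3,n−1], [1,n−2] of the Alexander matrix M_{n−1}. Then det M_{n−1}^{I'} = (−1)^n·(1 − t z²)^{n−2}·(1 − z)^{(n−2)²} in ℤ[t,z]; in particular det M_{n−1}^{I'} = ±(1 − t z²)^{n−2}·(1 − z)^{(n−2)²}. -/
open Matrix MvPolynomial

/-- The polynomial ring ℤ[t,z] in two commuting variables. -/
noncomputable abbrev Rtz : Type := MvPolynomial (Fin 2) ℤ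

/-- The variable `t` of ℤ[t,z]. -/
noncomputable def tv : Rtz := MvPolynomial.X 0

/-- The variable `z` of ℤ[t,z]. -/
noncomputable def zv : Rtz := MvPolynomial.X 1

/-- The Tong–Yang–Ma matrix ρ_i (1-based `i`, `1 ≤ i ≤ n-1`): the identity matrix except for a
2×2 block `[[0,1],[t,0]]` occupying rows and columns `i-1` and `i` (0-based indexing), i.e.
rows and columns `i` and `i+1` in 1-based indexing. -/
noncomputable def tymρ (n : ℕ) (i : ℕ) : Matrix (Fin n) (Fin n) Rtz :=
  Matrix.of fun p q =>
    if (p : ℕ) + 1 = i ∧ (q : ℕ) = i then 1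
    else if (p : ℕ) = i ∧ (q : ℕ) + 1 = i then tv
    else if (p : ℕ) = (q : ℕ) ∧ (p : ℕ) + 1 ≠ i ∧ (p : ℕ) ≠ i then 1
    else 0

/-- The `n × n` block of the Alexander matrix of the Artin presentation of `B_n` associated
with the Tong–Yang–Ma representation, in the row-block of the relation `[i,j]`
(`1 ≤ i < j ≤ n-1`, 1-based) and the column-block `c` (`1 ≤ c ≤ n-2`, 1-based). -/
noncomputable def alexBlock (n : ℕ) (i j c : ℕ) : Matrix (Fin n) (Fin n) Rtz :=
  if j = i + 1 then
    if c = i then 1 - zv • tymρ n (i + 1) + zv ^ 2 • (tymρ n i * tymρ n (i + 1))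
    else if c = i + 1 then zv • tymρ n i - zv ^ 2 • (tymρ n (i + 1) * tymρ n i) - 1
    else 0
  else
    if c = i then 1 - zv • tymρ n j
    else if c = j then zv • tymρ n i - 1
    else 0

/-- The row index set of the Alexander matrix `M_{n-1}`: a pair of a relation `[i,j]`
(`1 ≤ i < j ≤ n-1`, recorded 0-based as elements of `Fin (n-1)`) and a row `Fin n`
within the corresponding row-block. -/
def AlexRow (n : ℕ) : Type := {p : Fin (n - 1) × Fin (n - 1) // p.1 < p.2} × Fin n

/-- The Alexander matrix `M_{n-1}` of the Artin presentation of the braid group `B_n`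
associated with the Tong–Yang–Ma representation `σ_i ↦ ρ_i` and the abelianization
`σ_i ↦ z`, with the column-block corresponding to the generator `σ_{n-1}` removed.
Columns are indexed by pairs (column-block `Fin (n-2)` (0-based), column `Fin n` within
the block). -/
noncomputable def alexM (n : ℕ) : Matrix (AlexRow n) (Fin (n - 2) × Fin n) Rtz :=
  fun r c => alexBlock n ((r.1.1.1 : ℕ) + 1) ((r.1.1.2 : ℕ) + 1) ((c.1 : ℕ) + 1) r.2 c.2


/-- The determinant of a lower block-triangular matrix with equally sized blocks is the product
of the determinants of its diagonal blocks. -/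
theorem det_of_lowerBlockTriangular {m n R : Type*} [CommRing R] [Fintype m] [LinearOrder m]
    [Fintype n] [DecidableEq n] (M : Matrix (m × n) (m × n) R)
    (h : ∀ i j p q, i < j → M (i, p) (j, q) = 0) :
    M.det = ∏ i, (Matrix.of fun p q => M (i, p) (i, q)).det := by
  have hM : M.BlockTriangular (OrderDual.toDual ∘ Prod.fst) :=
    fun a b hab => h a.1 b.1 a.2 b.2 (OrderDual.toDual_lt_toDual.mp hab)
  rw [hM.det_fintype, ← OrderDual.toDual.prod_comp]
  refine Finset.prod_congr rfl fun i _ => ?_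
  let e : n ≃ {a : m × n // (OrderDual.toDual ∘ Prod.fst) a = OrderDual.toDual i} :=
    { toFun := fun p => ⟨(i, p), rfl⟩
      invFun := fun a => a.1.2
      left_inv := fun _ => rfl
      right_inv := by
        rintro ⟨⟨j, p⟩, hj⟩
        obtain rfl : j = i := hj
        rfl }
  rw [← det_submatrix_equiv_self e]
  rfl

/-- `det (1 - z ρ_i)` for `1 ≤ i ≤ n - 1`. -/
theorem det_one_sub_smul_tymρ {n i : ℕ} (hi : 1 ≤ i) (hin : i < n) :
    (1 - zv • tymρ n i).det = (1 - tv * zv ^ 2) * (1 - zv) ^ (n - 2) := by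
  let a : Fin n := ⟨i - 1, by omega⟩
  let b : Fin n := ⟨i, hin⟩
  have hab : b ≠ a := by simp only [a, b, ne_eq, Fin.mk.injEq]; omega
  rw [← det_updateCol_add_smul_self _ hab zv, det_of_isLowerTriangular]
  · have hdiag : ∀ p : Fin n,
        ((1 - zv • tymρ n i).updateCol b fun k =>
          (1 - zv • tymρ n i) k b + zv • (1 - zv • tymρ n i) k a) p p =
        (if p = b then 1 - tv * zv ^ 2 else 1) * (if p ∈ ({a, b} : Finset (Fin n)) then 1 else
          1 - zv) := by
      intro p
      by_cases hb : p = b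
      · subst hb
        simp [tymρ, a, b, hi, hab]
        grind
      · by_cases ha : p = a
        · subst ha
          simp [tymρ, a, b, hi, hb]
          grind
        · have h1 : (p : ℕ) ≠ i := fun h => hb (Fin.ext h)
          have h2 : (p : ℕ) + 1 ≠ i := fun h => ha (Fin.ext (by simp only [a]; omega))
          simp [tymρ, hb, ha, h1, h2]
    simp only [hdiag, Finset.prod_mul_distrib, Finset.prod_ite_eq', Finset.mem_univ, if_true]
    rw [Finset.prod_ite, Finset.prod_const_one, one_mul, Finset.prod_const,
      Finset.filter_notMem_eq_sdiff, Finset.card_univ_sdiff, Finset.card_pair hab.symm,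
      Fintype.card_fin]
  · intro p q hpq
    have hpq' : (p : ℕ) < q := hpq
    have hne : p ≠ q := hpq'.ne ∘ congrArg Fin.val
    by_cases hb : q = b
    · subst hb
      have h1 : p ≠ b := hne
      have h2 : (p : ℕ) < i := hpq
      by_cases ha : p = a
      · subst ha
        simp [tymρ, a, b, hi, h1]
        grind
      · have h3 : (p : ℕ) + 1 ≠ i := fun h => ha (Fin.ext (by simp only [a]; omega))
        simp [tymρ, a, b, ha, h1, h2.ne, h3]
        grind
    · have h1 : (q : ℕ) ≠ i := fun h => hb (Fin.ext h)
      have h2 : ¬ ((p : ℕ) = i ∧ (q : ℕ) + 1 = i) := by omega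
      simp [tymρ, hb, h1, h2, hpq'.ne, hne]

/-- Lemma 4.3 (ii): for `n ≥ 5`, choosing the rows of the `n-2` row-blocks
`[1,n-1], [2,n-1], …, [n-3,n-1], [1,n-2]` of the Alexander matrix `M_{n-1}`, the resulting
maximal minor equals `(-1)^n·(1-tz²)^{n-2}·(1-z)^{(n-2)²}`; in particular it equals
`±(1-tz²)^{n-2}·(1-z)^{(n-2)²}`. -/
theorem det_minor_last_column_blocks (n : ℕ) (hn : 5 ≤ n) :
    (((alexM n).submatrix
        (fun p : Fin (n - 2) × Fin n =>
          (if h : (p.1 : ℕ) < n - 3 then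
            ((⟨(⟨(p.1 : ℕ), by omega⟩, ⟨n - 2, by omega⟩),
                Fin.mk_lt_mk.mpr (by omega)⟩, p.2) : AlexRow n)
          else
            ((⟨(⟨0, by omega⟩, ⟨n - 3, by omega⟩),
                Fin.mk_lt_mk.mpr (by omega)⟩, p.2) : AlexRow n)))
        id).det)
      = (-1) ^ n * ((1 - tv * zv ^ 2) ^ (n - 2) * (1 - zv) ^ ((n - 2) ^ 2)) ∧
    ((((alexM n).submatrix
        (fun p : Fin (n - 2) × Fin n =>
          (if h : (p.1 : ℕ) < n - 3 then
            ((⟨(⟨(p.1 : ℕ), by omega⟩, ⟨n - 2, by omega⟩),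
                Fin.mk_lt_mk.mpr (by omega)⟩, p.2) : AlexRow n)
          else
            ((⟨(⟨0, by omega⟩, ⟨n - 3, by omega⟩),
                Fin.mk_lt_mk.mpr (by omega)⟩, p.2) : AlexRow n)))
        id).det)
        = (1 - tv * zv ^ 2) ^ (n - 2) * (1 - zv) ^ ((n - 2) ^ 2) ∨
     (((alexM n).submatrix
        (fun p : Fin (n - 2) × Fin n =>
          (if h : (p.1 : ℕ) < n - 3 then
            ((⟨(⟨(p.1 : ℕ), by omega⟩, ⟨n - 2, by omega⟩),
                Fin.mk_lt_mk.mpr (by omega)⟩, p.2) : AlexRow n)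
          else
            ((⟨(⟨0, by omega⟩, ⟨n - 3, by omega⟩),
                Fin.mk_lt_mk.mpr (by omega)⟩, p.2) : AlexRow n)))
        id).det)
        = -((1 - tv * zv ^ 2) ^ (n - 2) * (1 - zv) ^ ((n - 2) ^ 2))) := by
  set r : Fin (n - 2) × Fin n → AlexRow n := fun p =>
    if h : (p.1 : ℕ) < n - 3 then
      (⟨(⟨(p.1 : ℕ), by omega⟩, ⟨n - 2, by omega⟩), Fin.mk_lt_mk.mpr (by omega)⟩, p.2)
    else
      (⟨(⟨0, by omega⟩, ⟨n - 3, by omega⟩), Fin.mk_lt_mk.mpr (by omega)⟩, p.2) with hr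
  have hdet : ((alexM n).submatrix r id).det
      = (-1) ^ n * ((1 - tv * zv ^ 2) ^ (n - 2) * (1 - zv) ^ ((n - 2) ^ 2)) := by
    clear_value r
    obtain ⟨m, rfl⟩ : ∃ m, n = m + 3 := ⟨n - 3, by omega⟩
    rw [det_of_lowerBlockTriangular]
    · change ∏ i : Fin (m + 1), _ = _
      rw [Fin.prod_univ_castSucc]
      have hcast : ∀ i : Fin m, (Matrix.of fun p q => (alexM (m + 3)).submatrix r
          id (i.castSucc, p) (i.castSucc, q)) = 1 - zv • tymρ (m + 3) (m + 2) := by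
        intro i
        ext p q
        have := i.2
        simp [hr, alexM, alexBlock, this.ne']
      have hlast : (Matrix.of fun p q => (alexM (m + 3)).submatrix r
          id (Fin.last m, p) (Fin.last m, q)) = -(1 - zv • tymρ (m + 3) 1) := by
        ext p q
        have h1 : m ≠ 1 := by omega
        have h2 : m ≠ 0 := by omega
        simp [hr, alexM, alexBlock, h1, h2]
      rw [Finset.prod_congr rfl fun i _ => congrArg det (hcast i), hlast, det_neg,
        det_one_sub_smul_tymρ (by omega) (by omega), det_one_sub_smul_tymρ le_rfl (by omega),
        Finset.prod_const, Finset.card_univ, Fintype.card_fin, Fintype.card_fin]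
      rw [show m + 3 - 2 = m + 1 by omega, mul_pow, ← pow_mul]
      ring
    · intro i j p q hij
      have hij' : (i : ℕ) < j := hij
      have hj := j.2
      have hi : (i : ℕ) < m := by omega
      simp [hr, alexM, alexBlock, hi, hi.ne', hij'.ne', show (j : ℕ) ≠ m + 1 by omega]
  refine ⟨hdet, ?_⟩
  rw [hdet]
  rcases neg_one_pow_eq_or Rtz n with h | h
  · exact .inl (by rw [h, one_mul])
  · exact .inr (by rw [h, neg_one_mul])
end

section
/- Let n ≥ 4 and let I'' be the set of rows of the Alexander matrix M_{n−1} consisting of, for each k with 1 ≤ k ≤ n−3, the first n−1 rows of the row-block [k,n−1] together with the last (n-th) row of the row-block [k,n−2], together with all n rows of the row-block [n−2,n−1]. Then det M_{n−1}^{I''} = ±(1 − t z²)·(1 + t z³)·(1 − z + z²)^{n−2}·(1 − z)^{(n−1)(n−3)} in ℤ[t,z]. -/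
open Matrix MvPolynomial

/-- The determinant of a block upper triangular matrix whose blocks all have the same shape. -/
theorem Matrix.det_prod_of_blockTriangular {α β R : Type*} [CommRing R] [Fintype α]
    [LinearOrder α] [Fintype β] [DecidableEq β] (M : Matrix (α × β) (α × β) R)
    (h : ∀ i p j q, j < i → M (i, p) (j, q) = 0) :
    M.det = ∏ k, (Matrix.of fun p q => M (k, p) (k, q)).det := by
  have hM : M.BlockTriangular Prod.fst := fun x y hxy => h x.1 x.2 y.1 y.2 hxy
  rw [hM.det_fintype]
  refine Finset.prod_congr rfl fun k _ => ?_
  let e : β ≃ {x : α × β // x.1 = k} :=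
    { toFun := fun p => ⟨(k, p), rfl⟩
      invFun := fun x => x.1.2
      left_inv := fun _ => rfl
      right_inv := by
        rintro ⟨⟨_, _⟩, rfl⟩
        rfl }
  rw [← Matrix.det_submatrix_equiv_self e]
  rfl

/-- The determinant of a matrix that is a scalar matrix followed by a `3 × 3` block. -/
theorem Matrix.det_scalar_append_three {R : Type*} [CommRing R] (m : ℕ) (c : R)
    (A : Matrix (Fin (m + 3)) (Fin (m + 3)) R)
    (h : ∀ (i : Fin m) (j : Fin (m + 3)),
      A (Fin.castAdd 3 i) j = if Fin.castAdd 3 i = j then c else 0) :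
    A.det = c ^ m * (Matrix.of fun p q => A (Fin.natAdd m p) (Fin.natAdd m q)).det := by
  rw [← Matrix.det_submatrix_equiv_self finSumFinEquiv A,
    ← Matrix.fromBlocks_toBlocks (A.submatrix finSumFinEquiv finSumFinEquiv)]
  have h₁₂ : (A.submatrix finSumFinEquiv finSumFinEquiv).toBlocks₁₂ = 0 := by
    ext i j
    simp [Matrix.toBlocks₁₂, h, Fin.ext_iff]
    omega
  have h₁₁ : (A.submatrix finSumFinEquiv finSumFinEquiv).toBlocks₁₁
      = Matrix.diagonal fun _ : Fin m => c := by
    ext i j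
    simp [Matrix.toBlocks₁₁, h, Matrix.diagonal_apply, Fin.ext_iff]
  rw [h₁₂, Matrix.det_fromBlocks_zero₁₂, h₁₁, Matrix.det_diagonal]
  simp
  rfl

theorem tymρ_mul_apply_of_ne {n i : ℕ} (A : Matrix (Fin n) (Fin n) Rtz) (p q : Fin n)
    (h₁ : (p : ℕ) + 1 ≠ i) (h₂ : (p : ℕ) ≠ i) : (tymρ n i * A) p q = A p q := by
  rw [Matrix.mul_apply, Finset.sum_eq_single p]
  · simp [tymρ, h₁, h₂]
  · intro b _ hb
    simp [tymρ, h₁, h₂, Fin.val_inj, hb.symm]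
  · simp

theorem tymρ_mul_apply_upper {n i : ℕ} (A : Matrix (Fin n) (Fin n) Rtz) (p r q : Fin n)
    (hp : (p : ℕ) + 1 = i) (hr : (r : ℕ) = i) : (tymρ n i * A) p q = A r q := by
  rw [Matrix.mul_apply, Finset.sum_eq_single r]
  · simp [tymρ, hp, hr]
  · intro b _ hb
    have : (b : ℕ) ≠ i := fun h => hb (Fin.ext (h.trans hr.symm))
    simp [tymρ, hp, this]
    omega
  · simp

theorem tymρ_mul_apply_lower {n i : ℕ} (A : Matrix (Fin n) (Fin n) Rtz) (p r q : Fin n)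
    (hp : (p : ℕ) = i) (hr : (r : ℕ) + 1 = i) : (tymρ n i * A) p q = tv * A r q := by
  rw [Matrix.mul_apply, Finset.sum_eq_single r]
  · simp [tymρ, hp, hr]
  · intro b _ hb
    have : (b : ℕ) + 1 ≠ i := fun h => hb (Fin.ext (by omega))
    simp [tymρ, hp, this]
  · simp

theorem tymρ_apply_of_ne {n i : ℕ} (p q : Fin n)
    (h₁ : (p : ℕ) + 1 ≠ i) (h₂ : (p : ℕ) ≠ i) :
    tymρ n i p q = if p = q then 1 else 0 := by
  simp [tymρ, h₁, h₂, Fin.ext_iff]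

/-- The diagonal block of the relation `[n-2,n-1]`. -/
theorem det_alexBlock_last (m : ℕ) :
    (alexBlock (m + 4) (m + 2) (m + 3) (m + 2)).det
      = (1 - zv + zv ^ 2) ^ (m + 1)
        * ((1 - zv) * (1 - tv * zv ^ 2) * (1 + tv * zv ^ 3)) := by
  rw [Matrix.det_scalar_append_three (m + 1) (1 - zv + zv ^ 2)]
  · congr 1
    have h0 (q) := tymρ_mul_apply_upper (i := m + 2) (tymρ (m + 4) (m + 3))
      (Fin.natAdd (m + 1) (0 : Fin 3)) (Fin.natAdd (m + 1) (1 : Fin 3)) q rfl rfl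
    have h1 (q) := tymρ_mul_apply_lower (i := m + 2) (tymρ (m + 4) (m + 3))
      (Fin.natAdd (m + 1) (1 : Fin 3)) (Fin.natAdd (m + 1) (0 : Fin 3)) q rfl rfl
    have h2 (q) := tymρ_mul_apply_of_ne (i := m + 2) (tymρ (m + 4) (m + 3))
      (Fin.natAdd (m + 1) (2 : Fin 3)) q (by simp) (by simp)
    rw [Matrix.det_fin_three]
    simp only [alexBlock, Matrix.of_apply, Matrix.add_apply, Matrix.sub_apply,
      Matrix.smul_apply, h0, h1, h2, if_true, smul_eq_mul]
    simp [tymρ, Fin.ext_iff]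
    ring
  · intro i j
    have hi := i.isLt
    simp only [alexBlock, Matrix.add_apply, Matrix.sub_apply, Matrix.smul_apply, if_true,
      smul_eq_mul]
    rw [tymρ_mul_apply_of_ne _ _ _ (by simp; omega) (by simp; omega),
      tymρ_apply_of_ne _ _ (by simp; omega) (by simp; omega), Matrix.one_apply]
    split_ifs <;> ring

/-- The diagonal block assembled from the first `n-1` rows of `[k,n-1]` and a last row
that is a multiple of the last unit vector. -/
theorem det_commutation_rows (m k : ℕ) (hk : k ≤ m) (c : Rtz)
    (A : Matrix (Fin (m + 4)) (Fin (m + 4)) Rtz)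
    (h : ∀ p q : Fin (m + 4), (p : ℕ) < m + 3 →
      A p q = alexBlock (m + 4) (k + 1) (m + 3) (k + 1) p q)
    (hl : ∀ q, A (Fin.last (m + 3)) q = if Fin.last (m + 3) = q then c else 0) :
    A.det = (1 - zv) ^ (m + 2) * c := by
  have hA (p q : Fin (m + 4)) (hp : (p : ℕ) < m + 3) :
      A p q = (1 : Matrix (Fin (m + 4)) (Fin (m + 4)) Rtz) p q
        - zv * tymρ (m + 4) (m + 3) p q := by
    rw [h p q hp, alexBlock, if_neg (by omega), if_pos rfl]
    simp
  rw [Matrix.det_of_isUpperTriangular, Fin.prod_univ_castSucc, Fin.prod_univ_castSucc, hl,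
    if_pos rfl, hA _ _ (by simp)]
  · rw [Finset.prod_congr rfl (g := fun _ => 1 - zv)]
    · simp [tymρ]
    · intro i _
      have hi := i.isLt
      rw [hA _ _ (by simp; omega), tymρ_apply_of_ne _ _ (by simp; omega) (by simp; omega)]
      simp
  · intro p q hqp
    have hqp' : (q : ℕ) < p := hqp
    have hne : p ≠ q := ne_of_gt hqp
    by_cases hp : (p : ℕ) < m + 3
    · rw [hA p q hp, Matrix.one_apply_ne hne, tymρ, Matrix.of_apply, if_neg (by omega),
        if_neg (by omega), if_neg (by omega), mul_zero, sub_zero]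
    · obtain rfl : p = Fin.last (m + 3) := Fin.ext (by simp; omega)
      rw [hl, if_neg hne]

/-- The last row of `[k,n-2]` in the column-block `k`. -/
theorem alexBlock_penultimate_last_row (m k : ℕ) (hk : k ≤ m) (q : Fin (m + 4)) :
    alexBlock (m + 4) (k + 1) (m + 2) (k + 1) (Fin.last (m + 3)) q
      = if Fin.last (m + 3) = q then
          (if k = m then 1 - zv + zv ^ 2 else 1 - zv) else 0 := by
  rcases eq_or_lt_of_le hk with rfl | hk
  · simp only [alexBlock, Matrix.add_apply, Matrix.sub_apply, Matrix.smul_apply, if_true,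
      smul_eq_mul]
    rw [tymρ_mul_apply_of_ne _ _ _ (by simp) (by simp),
      tymρ_apply_of_ne _ _ (by simp) (by simp), Matrix.one_apply]
    split_ifs <;> ring
  · rw [alexBlock, if_neg (by omega), if_pos rfl, if_neg hk.ne, Matrix.sub_apply,
      Matrix.smul_apply, tymρ_apply_of_ne _ _ (by simp) (by simp), Matrix.one_apply]
    split_ifs <;> simp

/-- Lemma 4.3 (iii): for `n ≥ 4`, choosing, for each `1 ≤ k ≤ n-3`, the first `n-1` rows of
the row-block `[k,n-1]` together with the last row of the row-block `[k,n-2]`, and all `n`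
rows of the row-block `[n-2,n-1]`, the resulting maximal minor of the Alexander matrix
`M_{n-1}` equals `±(1-tz²)·(1+tz³)·(1-z+z²)^{n-2}·(1-z)^{(n-1)(n-3)}`. -/
theorem det_minor_modified_blocks (n : ℕ) (hn : 4 ≤ n) :
    (((alexM n).submatrix
        (fun p : Fin (n - 2) × Fin n =>
          (if h : (p.1 : ℕ) < n - 3 then
            (if (p.2 : ℕ) < n - 1 then
              ((⟨(⟨(p.1 : ℕ), by omega⟩, ⟨n - 2, by omega⟩),
                  Fin.mk_lt_mk.mpr (by omega)⟩, p.2) : AlexRow n)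
            else
              ((⟨(⟨(p.1 : ℕ), by omega⟩, ⟨n - 3, by omega⟩),
                  Fin.mk_lt_mk.mpr (by omega)⟩, p.2) : AlexRow n))
          else
            ((⟨(⟨n - 3, by omega⟩, ⟨n - 2, by omega⟩),
                Fin.mk_lt_mk.mpr (by omega)⟩, p.2) : AlexRow n)))
        id).det)
      = (1 - tv * zv ^ 2) * (1 + tv * zv ^ 3) * (1 - zv + zv ^ 2) ^ (n - 2)
          * (1 - zv) ^ ((n - 1) * (n - 3)) ∨
    (((alexM n).submatrix
        (fun p : Fin (n - 2) × Fin n =>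
          (if h : (p.1 : ℕ) < n - 3 then
            (if (p.2 : ℕ) < n - 1 then
              ((⟨(⟨(p.1 : ℕ), by omega⟩, ⟨n - 2, by omega⟩),
                  Fin.mk_lt_mk.mpr (by omega)⟩, p.2) : AlexRow n)
            else
              ((⟨(⟨(p.1 : ℕ), by omega⟩, ⟨n - 3, by omega⟩),
                  Fin.mk_lt_mk.mpr (by omega)⟩, p.2) : AlexRow n))
          else
            ((⟨(⟨n - 3, by omega⟩, ⟨n - 2, by omega⟩),
                Fin.mk_lt_mk.mpr (by omega)⟩, p.2) : AlexRow n)))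
        id).det)
      = -((1 - tv * zv ^ 2) * (1 + tv * zv ^ 3) * (1 - zv + zv ^ 2) ^ (n - 2)
          * (1 - zv) ^ ((n - 1) * (n - 3))) := by
  left
  obtain ⟨m, rfl⟩ : ∃ m, n = m + 4 := ⟨n - 4, by omega⟩
  generalize hM : (alexM (m + 4)).submatrix _ _ = M
  have hcomm (k j : Fin (m + 2)) (p q : Fin (m + 4)) (hk : (k : ℕ) < m + 1)
      (hp : (p : ℕ) < m + 3) :
      M (k, p) (j, q) = alexBlock (m + 4) (k + 1) (m + 3) (j + 1) p q := by
    subst hM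
    simp [alexM, hk, hp]
  have hpen (k j : Fin (m + 2)) (q : Fin (m + 4)) (hk : (k : ℕ) < m + 1) :
      M (k, Fin.last (m + 3)) (j, q)
        = alexBlock (m + 4) (k + 1) (m + 2) (j + 1) (Fin.last (m + 3)) q := by
    subst hM
    simp [alexM, hk]
  have hlast (j : Fin (m + 2)) (p q : Fin (m + 4)) :
      M (Fin.last (m + 1), p) (j, q) = alexBlock (m + 4) (m + 2) (m + 3) (j + 1) p q := by
    subst hM
    simp [alexM]
  have htri (i : Fin (m + 2)) (p : Fin (m + 4)) (j : Fin (m + 2)) (q : Fin (m + 4))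
      (hji : j < i) : M (i, p) (j, q) = 0 := by
    have hji' : (j : ℕ) < i := hji
    by_cases hi : (i : ℕ) < m + 1
    · by_cases hp : (p : ℕ) < m + 3
      · rw [hcomm _ _ _ _ hi hp, alexBlock, if_neg (by omega), if_neg (by omega),
          if_neg (by omega), Matrix.zero_apply]
      · obtain rfl : p = Fin.last (m + 3) := Fin.ext (by simp; omega)
        rw [hpen _ _ _ hi, alexBlock]
        repeat rw [if_neg (by omega : ¬ (j : ℕ) + 1 = _)]
        rw [ite_self, Matrix.zero_apply]
    · obtain rfl : i = Fin.last (m + 1) := Fin.ext (by simp; omega)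
      rw [hlast, alexBlock, if_pos rfl, if_neg (by omega), if_neg (by omega),
        Matrix.zero_apply]
  have hdet (k : Fin (m + 1)) :
      (Matrix.of fun p q => M (k.castSucc, p) (k.castSucc, q)).det
        = (1 - zv) ^ (m + 2) * if (k : ℕ) = m then 1 - zv + zv ^ 2 else 1 - zv := by
    refine det_commutation_rows m k (by omega) _ _ (fun p q hp => ?_) fun q => ?_
    · exact hcomm _ _ _ _ k.isLt hp
    · exact (hpen _ _ _ k.isLt).trans (alexBlock_penultimate_last_row m k (by omega) q)
  have hdet_last : (Matrix.of fun p q => M (Fin.last (m + 1), p) (Fin.last (m + 1), q))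
      = alexBlock (m + 4) (m + 2) (m + 3) (m + 2) := by
    funext p q
    exact hlast _ p q
  have hne (k : Fin m) : (k : ℕ) ≠ m := k.isLt.ne
  rw [Matrix.det_prod_of_blockTriangular M htri]
  change ∏ k : Fin (m + 2), _ = _
  rw [Fin.prod_univ_castSucc, Finset.prod_congr rfl fun k _ => hdet k,
    Fin.prod_univ_castSucc, hdet_last, det_alexBlock_last]
  simp only [Fin.val_castSucc, Fin.val_last, hne, if_true, if_false, Finset.prod_const,
    Finset.card_univ, Fintype.card_fin, Nat.reduceSubDiff]
  generalize 1 - zv + zv ^ 2 = b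
  generalize 1 - zv = a
  ring
end

section
/- Let n ≥ 4. The polynomial (1 − z)^{n−2}·(1 − t z²) is a greatest common divisor in ℤ[t,z] of the family of all maximal minors det M_{n−1}^I of the Alexander matrix M_{n−1}, where I ranges over all choices of (n−2)·n rows: it divides every det M_{n−1}^I, and every polynomial dividing all det M_{n−1}^I divides (1 − z)^{n−2}·(1 − t z²). Consequently the twisted Alexander invariant of the braid group B_n (n ≥ 4) associated with the Tong–Yang–Ma representation TYM_n and the abelianization σ_i ↦ z equals 1. -/
open Matrix MvPolynomial

theorem tymρ_mul_apply {n s : ℕ} (hs : s + 1 < n) (A : Matrix (Fin n) (Fin n) Rtz) (p q : Fin n) :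
    (tymρ n (s + 1) * A) p q =
      if (p : ℕ) = s then A ⟨s + 1, hs⟩ q
      else if (p : ℕ) = s + 1 then tv * A ⟨s, by omega⟩ q
      else A p q := by
  rw [Matrix.mul_apply]
  split_ifs with h1 h2
  · rw [Finset.sum_eq_single ⟨s + 1, hs⟩]
    · simp [tymρ, h1]
    · intro b _ hb
      have hb' : (b : ℕ) ≠ s + 1 := fun h => hb (Fin.ext h)
      simp [tymρ, h1, hb']
    · simp
  · rw [Finset.sum_eq_single ⟨s, by omega⟩]
    · simp [tymρ, h2]
    · intro b _ hb
      have hb' : (b : ℕ) ≠ s := fun h => hb (Fin.ext h)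
      simp [tymρ, h2, hb']
    · simp
  · rw [Finset.sum_eq_single p]
    · simp [tymρ, h1, h2]
    · intro b _ hb
      have hb' : (p : ℕ) ≠ b := fun h => hb (Fin.ext h.symm)
      simp [tymρ, h1, h2, hb']
    · simp

theorem tymρ_braid {n s : ℕ} (hs : s + 2 < n) :
    tymρ n (s + 1) * (tymρ n (s + 2) * tymρ n (s + 1)) =
      tymρ n (s + 2) * (tymρ n (s + 1) * tymρ n (s + 2)) := by
  ext1 p q
  have h1 : s + 1 < n := by omega
  have h2 : s + 1 + 1 < n := hs
  rcases (by omega : (p : ℕ) = s ∨ (p : ℕ) = s + 1 ∨ (p : ℕ) = s + 2 ∨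
    ((p : ℕ) ≠ s ∧ (p : ℕ) ≠ s + 1 ∧ (p : ℕ) ≠ s + 2)) with hp | hp | hp | ⟨hp, hp', hp''⟩ <;>
  simp [tymρ_mul_apply h1, tymρ_mul_apply h2, -mul_eq_mul_left_iff, *] <;>
  simp [tymρ, -mul_eq_mul_left_iff, *] <;>
  split_ifs <;> first | rfl | omega

theorem tymρ_commute {n s r : ℕ} (hsr : s + 1 < r) (hr : r + 1 < n) :
    tymρ n (s + 1) * tymρ n (r + 1) = tymρ n (r + 1) * tymρ n (s + 1) := by
  ext1 p q
  rw [tymρ_mul_apply (by omega), tymρ_mul_apply hr]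
  simp only [tymρ, Matrix.of_apply]
  split_ifs <;> first | rfl | omega | ring

theorem one_sub_tymρ_apply {n s : ℕ} (p q : Fin n) :
    (1 - zv • tymρ n (s + 1)) p q =
      if (p : ℕ) = s then
        (if (q : ℕ) = s then 1 else if (q : ℕ) = s + 1 then -zv else 0)
      else if (p : ℕ) = s + 1 then
        (if (q : ℕ) = s then -(tv * zv) else if (q : ℕ) = s + 1 then 1 else 0)
      else if (p : ℕ) = q then 1 - zv else 0 := by
  simp only [tymρ, Matrix.sub_apply, Matrix.smul_apply, Matrix.of_apply, Matrix.one_apply,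
    Fin.ext_iff, smul_eq_mul]
  split_ifs <;> first | omega | ring

theorem braid_left_apply {n s : ℕ} (hs : s + 2 < n) (p q : Fin n) :
    (1 - zv • tymρ n (s + 2) + zv ^ 2 • (tymρ n (s + 1) * tymρ n (s + 2))) p q =
      if (p : ℕ) = s then
        (if (q : ℕ) = s then 1 - zv else if (q : ℕ) = s + 2 then zv ^ 2 else 0)
      else if (p : ℕ) = s + 1 then
        (if (q : ℕ) = s then tv * zv ^ 2 else if (q : ℕ) = s + 1 then 1
          else if (q : ℕ) = s + 2 then -zv else 0)
      else if (p : ℕ) = s + 2 then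
        (if (q : ℕ) = s + 1 then -(tv * zv * (1 - zv)) else if (q : ℕ) = s + 2 then 1 else 0)
      else if (p : ℕ) = q then 1 - zv + zv ^ 2 else 0 := by
  simp only [Matrix.add_apply, Matrix.sub_apply, Matrix.smul_apply, smul_eq_mul,
    tymρ_mul_apply (show s + 1 < n by omega)]
  rcases (by omega : (p : ℕ) = s ∨ (p : ℕ) = s + 1 ∨ (p : ℕ) = s + 2 ∨
    ((p : ℕ) ≠ s ∧ (p : ℕ) ≠ s + 1 ∧ (p : ℕ) ≠ s + 2)) with hp | hp | hp | ⟨hp, hp', hp''⟩ <;>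
  simp [tymρ, Matrix.one_apply, Fin.ext_iff, *] <;>
  split_ifs <;> first | omega | ring

theorem braid_right_apply {n s : ℕ} (hs : s + 2 < n) (p q : Fin n) :
    (zv • tymρ n (s + 1) - zv ^ 2 • (tymρ n (s + 2) * tymρ n (s + 1)) - 1) p q =
      if (p : ℕ) = s then
        (if (q : ℕ) = s then -1 else if (q : ℕ) = s + 1 then zv * (1 - zv) else 0)
      else if (p : ℕ) = s + 1 then
        (if (q : ℕ) = s then tv * zv else if (q : ℕ) = s + 1 then -1
          else if (q : ℕ) = s + 2 then -zv ^ 2 else 0)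
      else if (p : ℕ) = s + 2 then
        (if (q : ℕ) = s then -(tv ^ 2 * zv ^ 2) else if (q : ℕ) = s + 2 then zv - 1 else 0)
      else if (p : ℕ) = q then -(1 - zv + zv ^ 2) else 0 := by
  simp only [Matrix.sub_apply, Matrix.smul_apply, smul_eq_mul,
    tymρ_mul_apply (s := s + 1) hs]
  rcases (by omega : (p : ℕ) = s ∨ (p : ℕ) = s + 1 ∨ (p : ℕ) = s + 2 ∨
    ((p : ℕ) ≠ s ∧ (p : ℕ) ≠ s + 1 ∧ (p : ℕ) ≠ s + 2)) with hp | hp | hp | ⟨hp, hp', hp''⟩ <;>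
  simp [tymρ, Matrix.one_apply, Fin.ext_iff, *] <;>
  split_ifs <;> first | omega | ring

theorem alexBlock_fundamental {n a b : ℕ} (hab : a < b) (hb : b + 1 < n) :
    alexBlock n (a + 1) (b + 1) (a + 1) * (zv • tymρ n (a + 1) - 1) +
      alexBlock n (a + 1) (b + 1) (b + 1) * (zv • tymρ n (b + 1) - 1) = 0 := by
  by_cases h : b = a + 1
  · subst h
    have key := tymρ_braid (n := n) (s := a) hb
    simp only [alexBlock, if_true, show a + 1 + 1 ≠ a + 1 by omega, if_false]
    generalize tymρ n (a + 1) = X at *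
    generalize tymρ n (a + 1 + 1) = Y at *
    have key' : X * Y * X = Y * X * Y := by simpa only [mul_assoc] using key
    simp only [add_mul, sub_mul, mul_sub, smul_mul_assoc, mul_smul_comm, one_mul, mul_one,
      key', smul_sub]
    module
  · have key := tymρ_commute (n := n) (s := a) (r := b) (by omega) hb
    simp only [alexBlock, show b + 1 ≠ a + 1 + 1 by omega, if_true, if_false,
      show b + 1 ≠ a + 1 by omega]
    simp only [sub_mul, mul_sub, smul_mul_assoc, mul_smul_comm, one_mul, mul_one, key, smul_sub]
    module

theorem det_eq_prod_mul_det_submatrix {ι κ S : Type*} [Fintype ι] [DecidableEq ι] [Fintype κ]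
    [DecidableEq κ] [CommRing S] (A : Matrix ι ι S) (e : κ → ι) (he : Function.Injective e)
    (h : ∀ p, p ∉ Set.range e → ∀ q, q ≠ p → A p q = 0) :
    A.det = (∏ p : {p // p ∉ Set.range e}, A p p) * (A.submatrix e e).det := by
  classical
  rw [Matrix.twoBlockTriangular_det A (· ∈ Set.range e)
    (fun i hi j hj => h i hi j (by rintro rfl; exact hi hj)), mul_comm]
  congr 1
  · have : A.toSquareBlockProp (· ∉ Set.range e) =
        Matrix.diagonal fun p : {p // p ∉ Set.range e} => A p p := by
      ext p q
      by_cases hpq : p = q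
      · subst hpq; simp [Matrix.toSquareBlockProp]
      · rw [Matrix.diagonal_apply_ne _ hpq]
        exact h p p.2 q (fun h => hpq (Subtype.ext h.symm))
    rw [← Matrix.det_diagonal, ← this]
  · convert (Matrix.det_submatrix_equiv_self (Equiv.ofInjective e he)
      (A.toSquareBlockProp (· ∈ Set.range e))).symm
    rfl

theorem det_eq_prod_det_of_upper {S : Type*} [CommRing S] {m n : ℕ}
    (A : Matrix (Fin m × Fin n) (Fin m × Fin n) S)
    (h : ∀ i j a b, j < i → A (i, a) (j, b) = 0) :
    A.det = ∏ i, (Matrix.of fun a b => A (i, a) (i, b)).det := by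
  have hA : A.BlockTriangular Prod.fst := fun i j hij => h i.1 j.1 i.2 j.2 hij
  rw [hA.det_fintype]
  refine Finset.prod_congr rfl fun k _ => ?_
  let e : Fin n ≃ {a : Fin m × Fin n // a.1 = k} :=
    { toFun := fun a => ⟨(k, a), rfl⟩
      invFun := fun x => x.1.2
      left_inv := fun _ => rfl
      right_inv := by rintro ⟨⟨_, _⟩, rfl⟩; rfl }
  rw [← Matrix.det_submatrix_equiv_self e]
  rfl

theorem det_eq_prod_det_of_lower {S : Type*} [CommRing S] {m n : ℕ}
    (A : Matrix (Fin m × Fin n) (Fin m × Fin n) S)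
    (h : ∀ i j a b, i < j → A (i, a) (j, b) = 0) :
    A.det = ∏ i, (Matrix.of fun a b => A (i, a) (i, b)).det := by
  rw [← Matrix.det_transpose, det_eq_prod_det_of_upper Aᵀ fun i j a b hij => h j i b a hij]
  refine Finset.prod_congr rfl fun i _ => ?_
  rw [← Matrix.det_transpose]
  rfl

theorem isUnit_of_dvd_of_dvd_one_add {q g : Rtz} {f : MvPolynomial (Fin 1) ℤ} (hf : f ≠ 0)
    (h1 : q ∣ (MvPolynomial.finSuccEquiv ℤ 1).symm (Polynomial.C f)) (h2 : q ∣ 1 + tv * g) :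
    IsUnit q := by
  have h1' := map_dvd (MvPolynomial.finSuccEquiv ℤ 1) h1
  have h2' := map_dvd (MvPolynomial.finSuccEquiv ℤ 1) h2
  rw [AlgEquiv.apply_symm_apply] at h1'
  have hd : (MvPolynomial.finSuccEquiv ℤ 1 q).natDegree = 0 := by
    have := Polynomial.natDegree_le_of_dvd h1' (by simpa using hf)
    simpa using this
  obtain ⟨c, hc⟩ : ∃ c, MvPolynomial.finSuccEquiv ℤ 1 q = Polynomial.C c :=
    ⟨_, Polynomial.eq_C_of_natDegree_eq_zero hd⟩
  have h3 := map_dvd (Polynomial.evalRingHom (0 : MvPolynomial (Fin 1) ℤ)) h2'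
  have h4 : IsUnit c := by
    rw [hc] at h3
    simpa [tv, MvPolynomial.finSuccEquiv_X_zero, isUnit_iff_dvd_one] using h3
  rw [← MulEquiv.isUnit_map (MvPolynomial.finSuccEquiv ℤ 1), hc]
  exact h4.map Polynomial.C

theorem det_eq_pow_mul_det_submatrix {ι κ S : Type*} [Fintype ι] [DecidableEq ι] [Fintype κ]
    [DecidableEq κ] [CommRing S] (A : Matrix ι ι S) (e : κ → ι) (he : Function.Injective e) (c : S)
    (h : ∀ p, p ∉ Set.range e → ∀ q, A p q = if p = q then c else 0) :
    A.det = c ^ (Fintype.card ι - Fintype.card κ) * (A.submatrix e e).det := by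
  classical
  rw [det_eq_prod_mul_det_submatrix A e he fun p hp q hq => by rw [h p hp, if_neg hq.symm]]
  congr 1
  rw [Finset.prod_congr rfl fun p _ => by rw [h p.1 p.2, if_pos rfl], Finset.prod_const,
    Finset.card_univ]
  congr 1
  rw [Fintype.card_subtype_compl, ← Set.card_range_of_injective he]

theorem sum_alexBlock_mul_eq_zero {n a b : ℕ} (hab : a < b) (hb : b < n - 1) :
    ∑ c ∈ Finset.range (n - 1),
      alexBlock n (a + 1) (b + 1) (c + 1) * (zv • tymρ n (c + 1) - 1) = 0 := by
  rw [Finset.sum_eq_add a b hab.ne, alexBlock_fundamental hab (by omega)]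
  · rintro c - ⟨hca, hcb⟩
    have : alexBlock n (a + 1) (b + 1) (c + 1) = 0 := by
      unfold alexBlock
      split_ifs <;> first | rfl | omega
    rw [this, zero_mul]
  · intro h; exact absurd (Finset.mem_range.2 (by omega)) h
  · intro h; exact absurd (Finset.mem_range.2 hb) h

theorem alexM_mulVec_coboundary {n : ℕ} (hn : 2 ≤ n) (u w : Fin n → Rtz) (d : Rtz)
    (hu : (zv • tymρ n (n - 1) - 1) *ᵥ u = d • w) (r : AlexRow n) :
    ∑ c, alexM n r c * ((zv • tymρ n ((c.1 : ℕ) + 1) - 1) *ᵥ u) c.2 =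
      d * -(alexBlock n ((r.1.1.1 : ℕ) + 1) ((r.1.1.2 : ℕ) + 1) (n - 1) *ᵥ w) r.2 := by
  obtain ⟨⟨⟨a, b⟩, hab⟩, k⟩ := r
  have h0 := sum_alexBlock_mul_eq_zero (n := n) (show (a : ℕ) < b from hab) b.2
  have hn1 : n - 2 + 1 = n - 1 := by omega
  rw [← congrArg Finset.range hn1, Finset.sum_range_succ, hn1, add_eq_zero_iff_eq_neg] at h0
  have h1 := congrArg (fun A => (A *ᵥ u) k) h0
  simp only [Matrix.neg_mulVec, ← Matrix.mulVec_mulVec, hu] at h1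
  rw [Matrix.sum_mulVec, Finset.sum_apply, Finset.sum_range] at h1
  rw [Fintype.sum_prod_type]
  simp only [← Matrix.mulVec_mulVec] at h1
  refine Eq.trans h1 ?_
  simp [Matrix.mulVec_smul]

theorem det_one_sub_tymρ {n s : ℕ} (hs : s + 1 < n) :
    (1 - zv • tymρ n (s + 1)).det = (1 - zv) ^ (n - 2) * (1 - tv * zv ^ 2) := by
  rw [det_eq_pow_mul_det_submatrix _ ![⟨s, by omega⟩, ⟨s + 1, hs⟩] _ (1 - zv)]
  · rw [Matrix.det_fin_two]
    simp only [Matrix.submatrix_apply, one_sub_tymρ_apply]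
    simp
    left
    ring
  · intro p hp q
    have h1 : (p : ℕ) ≠ s := fun h => hp ⟨0, Fin.ext h.symm⟩
    have h2 : (p : ℕ) ≠ s + 1 := fun h => hp ⟨1, Fin.ext h.symm⟩
    rw [one_sub_tymρ_apply, if_neg h1, if_neg h2]
    simp only [Fin.ext_iff]
  · intro i j
    fin_cases i <;> fin_cases j <;> simp

theorem det_braid_left {n s : ℕ} (hs : s + 2 < n) :
    (1 - zv • tymρ n (s + 2) + zv ^ 2 • (tymρ n (s + 1) * tymρ n (s + 2))).det =
      (1 - zv + zv ^ 2) ^ (n - 3) * ((1 - zv) * (1 - tv * zv ^ 2) * (1 + tv * zv ^ 3)) := by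
  rw [det_eq_pow_mul_det_submatrix _
    ![⟨s, by omega⟩, ⟨s + 1, by omega⟩, ⟨s + 2, hs⟩] _ (1 - zv + zv ^ 2)]
  · rw [Matrix.det_fin_three]
    simp only [Matrix.submatrix_apply, braid_left_apply hs]
    simp
    left
    ring
  · intro p hp q
    have h1 : (p : ℕ) ≠ s := fun h => hp ⟨0, Fin.ext h.symm⟩
    have h2 : (p : ℕ) ≠ s + 1 := fun h => hp ⟨1, Fin.ext h.symm⟩
    have h3 : (p : ℕ) ≠ s + 2 := fun h => hp ⟨2, Fin.ext h.symm⟩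
    rw [braid_left_apply hs, if_neg h1, if_neg h2, if_neg h3]
    simp only [Fin.ext_iff]
  · intro i j
    fin_cases i <;> fin_cases j <;> simp

theorem finSuccEquiv_zv : MvPolynomial.finSuccEquiv ℤ 1 zv = Polynomial.C (X 0) :=
  MvPolynomial.finSuccEquiv_X_succ (j := 0)

theorem isUnit_of_dvd_one_sub_of_dvd {q g : Rtz} (h1 : q ∣ 1 - zv) (h2 : q ∣ 1 + tv * g) :
    IsUnit q := by
  refine isUnit_of_dvd_of_dvd_one_add (f := 1 - X 0) ?_ ?_ h2
  · intro h
    simpa using congrArg (MvPolynomial.eval fun _ => (0 : ℤ)) h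
  · convert h1
    rw [AlgEquiv.symm_apply_eq]
    simp [finSuccEquiv_zv]

theorem isUnit_of_dvd_cyclotomic_of_dvd {q g : Rtz} (h1 : q ∣ 1 - zv + zv ^ 2)
    (h2 : q ∣ 1 + tv * g) : IsUnit q := by
  refine isUnit_of_dvd_of_dvd_one_add (f := 1 - X 0 + X 0 ^ 2) ?_ ?_ h2
  · intro h
    simpa using congrArg (MvPolynomial.eval fun _ => (0 : ℤ)) h
  · convert h1
    rw [AlgEquiv.symm_apply_eq]
    simp [finSuccEquiv_zv]

theorem smul_tymρ_sub_one_mulVec {n s : ℕ} (hs : s + 1 < n) (u : Fin n → Rtz) (p : Fin n) :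
    ((zv • tymρ n (s + 1) - 1) *ᵥ u) p =
      zv * (if (p : ℕ) = s then u ⟨s + 1, hs⟩
        else if (p : ℕ) = s + 1 then tv * u ⟨s, by omega⟩ else u p) - u p := by
  have h : (tymρ n (s + 1) *ᵥ u) p = _ := tymρ_mul_apply hs (Matrix.of fun a _ => u a) p p
  rw [Matrix.sub_mulVec, Matrix.one_mulVec, Matrix.smul_mulVec, Pi.sub_apply, Pi.smul_apply, h]
  rfl

theorem one_sub_mul_sq_dvd_minor {n : ℕ} (hn : 4 ≤ n) (f : Fin (n - 2) × Fin n → AlexRow n) :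
    1 - tv * zv ^ 2 ∣ ((alexM n).submatrix f id).det := by
  set A := (alexM n).submatrix f id
  let u : Fin n → Rtz := fun p => if (p : ℕ) = n - 2 then zv else if (p : ℕ) = n - 1 then 1 else 0
  let w : Fin n → Rtz := Pi.single ⟨n - 1, by omega⟩ (-1)
  have hu : (zv • tymρ n (n - 1) - 1) *ᵥ u = (1 - tv * zv ^ 2) • w := by
    ext1 p
    rw [show n - 1 = n - 2 + 1 by omega, smul_tymρ_sub_one_mulVec (by omega)]
    simp only [u, w, Pi.smul_apply, Pi.single_apply, Fin.ext_iff, smul_eq_mul]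
    split_ifs <;> first | omega | ring
  let v : Fin (n - 2) × Fin n → Rtz := fun c => ((zv • tymρ n ((c.1 : ℕ) + 1) - 1) *ᵥ u) c.2
  have hv : ∃ y, A *ᵥ v = (1 - tv * zv ^ 2) • y :=
    ⟨_, funext fun r => alexM_mulVec_coboundary (by omega) u w _ hu (f r)⟩
  obtain ⟨y, hy⟩ := hv
  have h1 : A.det • v = (1 - tv * zv ^ 2) • (A.adjugate *ᵥ y) := by
    rw [← Matrix.mulVec_smul, ← hy, Matrix.mulVec_mulVec, Matrix.adjugate_mul, Matrix.smul_mulVec,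
      Matrix.one_mulVec]
  have h2 : v (⟨n - 3, by omega⟩, ⟨n - 2, by omega⟩) = -zv := by
    simp only [v, u]
    rw [smul_tymρ_sub_one_mulVec (by omega)]
    dsimp only
    split_ifs <;> first | omega | ring
  have h3 := congrFun h1 (⟨n - 3, by omega⟩, ⟨n - 2, by omega⟩)
  simp only [Pi.smul_apply, h2, smul_eq_mul] at h3
  refine ⟨A.det - tv * zv * (A.adjugate *ᵥ y) (⟨n - 3, by omega⟩, ⟨n - 2, by omega⟩), ?_⟩
  linear_combination (-(tv * zv)) * h3

theorem one_sub_pow_dvd_minor {n : ℕ} (hn : 4 ≤ n) (f : Fin (n - 2) × Fin n → AlexRow n) :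
    (1 - zv) ^ (n - 2) ∣ ((alexM n).submatrix f id).det := by
  set A := (alexM n).submatrix f id
  let Q : Matrix (Fin (n - 2) × Fin n) (Fin (n - 2) × Fin n) Rtz := Matrix.of fun r c =>
    if (c.1 : ℕ) = c.2 then ((zv • tymρ n ((r.1 : ℕ) + 1) - 1) *ᵥ Pi.single c.2 1) r.2
    else if r = c then 1 else 0
  have hQ : Q.det = (-1) ^ (n - 2) := by
    rw [← Matrix.det_transpose, det_eq_pow_mul_det_submatrix Qᵀ
      (fun k : Fin (n - 2) => (k, Fin.castLE (by omega) k)) _ 1, one_pow, one_mul]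
    · rw [← Matrix.det_transpose, Matrix.det_of_isUpperTriangular]
      · rw [Finset.prod_congr rfl (g := fun _ => -1)]
        · simp
        · intro k _
          simp only [Q, Matrix.transpose_apply, Matrix.submatrix_apply, Matrix.of_apply]
          rw [smul_tymρ_sub_one_mulVec (by omega)]
          simp [Fin.ext_iff]
      · intro i j hij
        have hij' : (j : ℕ) < i := hij
        simp only [Q, Matrix.transpose_apply, Matrix.submatrix_apply, Matrix.of_apply]
        rw [smul_tymρ_sub_one_mulVec (by omega)]
        simp [Fin.ext_iff, hij'.ne', (show (i : ℕ) + 1 ≠ j by omega)]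
    · intro p hp q
      have hp' : (p.1 : ℕ) ≠ p.2 := fun h => hp ⟨p.1, Prod.ext rfl (Fin.ext h)⟩
      simp only [Q, Matrix.transpose_apply, Matrix.of_apply, if_neg hp', eq_comm]
    · intro i j h
      exact (Prod.ext_iff.1 h).1
  have hcol : ∀ c : Fin (n - 2) × Fin n, ∃ y : Fin (n - 2) × Fin n → Rtz, ∀ r,
      (A * Q) r c = (if (c.1 : ℕ) = c.2 then 1 - zv else 1) * y r := by
    intro c
    split_ifs with hc
    · have hu : (zv • tymρ n (n - 1) - 1) *ᵥ Pi.single c.2 1 = (1 - zv) • -Pi.single c.2 1 := by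
        ext1 p
        rw [show n - 1 = n - 2 + 1 by omega, smul_tymρ_sub_one_mulVec (by omega)]
        simp only [Pi.smul_apply, Pi.neg_apply, Pi.single_apply, Fin.ext_iff, smul_eq_mul]
        have := c.1.2
        split_ifs <;> first | omega | ring
      refine ⟨_, fun r => Eq.trans ?_ (alexM_mulVec_coboundary (by omega) _ _ _ hu (f r))⟩
      rw [Matrix.mul_apply]
      simp only [Q, Matrix.of_apply, if_pos hc]
      rfl
    · refine ⟨fun r => A r c, fun r => ?_⟩
      simp [Matrix.mul_apply, Q, hc]
  choose y hy using hcol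
  have hAQ : A * Q = Matrix.of fun r c => (if (c.1 : ℕ) = c.2 then 1 - zv else 1) *
      (Matrix.of fun r c => y c r) r c := by
    ext1 r c
    exact hy c r
  have hdet := congrArg Matrix.det hAQ
  rw [Matrix.det_mul, Matrix.det_mul_row, hQ, Fintype.prod_prod_type] at hdet
  have hprod : ∏ k : Fin (n - 2), ∏ j : Fin n, (if (k : ℕ) = j then 1 - zv else 1) =
      (1 - zv) ^ (n - 2) := by
    rw [Finset.prod_congr rfl (g := fun _ => 1 - zv)]
    · simp
    · intro k _
      rw [Finset.prod_eq_single (Fin.castLE (by omega) k)]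
      · simp
      · intro j _ hj
        rw [if_neg]
        exact fun h => hj (Fin.ext h.symm)
      · simp
  rw [hprod] at hdet
  refine ((isUnit_one.neg.pow (n - 2)).dvd_mul_right).1 ⟨_, hdet⟩

theorem mul_dvd_minor {n : ℕ} (hn : 4 ≤ n) (f : Fin (n - 2) × Fin n → AlexRow n) :
    (1 - zv) ^ (n - 2) * (1 - tv * zv ^ 2) ∣ ((alexM n).submatrix f id).det := by
  have h : IsRelPrime (1 - zv) (1 - tv * zv ^ 2) := fun q h1 h2 =>
    isUnit_of_dvd_one_sub_of_dvd (g := -zv ^ 2) h1 (by convert h2 using 1; ring)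
  exact h.pow_left.mul_dvd (one_sub_pow_dvd_minor hn f) (one_sub_mul_sq_dvd_minor hn f)

/-- The row `k` of the row-block of the relation `[a + 1, b + 1]`. -/
def alexRow {n a b : ℕ} (hab : a < b) (hb : b < n - 1) (k : Fin n) : AlexRow n :=
  (⟨(⟨a, hab.trans hb⟩, ⟨b, hb⟩), hab⟩, k)

theorem alexM_alexRow {n a b : ℕ} (hab : a < b) (hb : b < n - 1) (k : Fin n)
    (c : Fin (n - 2)) (q : Fin n) :
    alexM n (alexRow hab hb k) (c, q) = alexBlock n (a + 1) (b + 1) (c + 1) k q := rfl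

theorem alexBlock_comm_left {n a b : ℕ} (h : b ≠ a + 1) :
    alexBlock n (a + 1) (b + 1) (a + 1) = 1 - zv • tymρ n (b + 1) := by
  simp [alexBlock, h]

theorem alexBlock_comm_right {n a b : ℕ} (h : b ≠ a + 1) (h' : b ≠ a) :
    alexBlock n (a + 1) (b + 1) (b + 1) = -(1 - zv • tymρ n (a + 1)) := by
  simp [alexBlock, h, h']

theorem alexBlock_braid_left {n a : ℕ} :
    alexBlock n (a + 1) (a + 2) (a + 1) =
      1 - zv • tymρ n (a + 2) + zv ^ 2 • (tymρ n (a + 1) * tymρ n (a + 2)) := by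
  simp [alexBlock]

theorem alexBlock_braid_right {n a : ℕ} :
    alexBlock n (a + 1) (a + 2) (a + 2) =
      zv • tymρ n (a + 1) - zv ^ 2 • (tymρ n (a + 2) * tymρ n (a + 1)) - 1 := by
  simp [alexBlock]

theorem alexBlock_eq_zero {n a b c : ℕ} (ha : c ≠ a) (hb : c ≠ b) :
    alexBlock n a b c = 0 := by
  unfold alexBlock
  split_ifs <;> first | rfl | omega

theorem exists_minor_eq_braid {n : ℕ} (hn : 4 ≤ n) :
    ∃ f, ((alexM n).submatrix f id).det =
      ((1 - zv + zv ^ 2) ^ (n - 3) *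
        ((1 - zv) * (1 - tv * zv ^ 2) * (1 + tv * zv ^ 3))) ^ (n - 2) := by
  refine ⟨fun r => alexRow (Nat.lt_succ_self r.1) (by have := r.1.2; omega) r.2, ?_⟩
  rw [det_eq_prod_det_of_upper]
  · rw [Finset.prod_congr rfl (g := fun _ => (1 - zv + zv ^ 2) ^ (n - 3) *
        ((1 - zv) * (1 - tv * zv ^ 2) * (1 + tv * zv ^ 3)))]
    · simp
    · intro i _
      have := i.2
      rw [← det_braid_left (s := i) (by omega), ← alexBlock_braid_left]
      rfl
  · intro i j a b hji
    have hji' : (j : ℕ) < i := hji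
    simp only [Matrix.submatrix_apply, alexM_alexRow, id]
    rw [alexBlock_eq_zero (by omega) (by omega), Matrix.zero_apply]

theorem exists_minor_eq_commutation {n : ℕ} (hn : 5 ≤ n) :
    ∃ f, Associated ((alexM n).submatrix f id).det
      (((1 - zv) ^ (n - 2) * (1 - tv * zv ^ 2)) ^ (n - 2)) := by
  let f : Fin (n - 2) × Fin n → AlexRow n := fun r =>
    if h : (r.1 : ℕ) = n - 3 then alexRow (a := 0) (b := n - 3) (by omega) (by omega) r.2
    else alexRow (a := r.1) (b := n - 2) (by have := r.1.2; omega) (by omega) r.2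
  refine ⟨f, ?_⟩
  rw [det_eq_prod_det_of_lower]
  · rw [show ((1 - zv) ^ (n - 2) * (1 - tv * zv ^ 2)) ^ (n - 2) =
      ∏ _i : Fin (n - 2), (1 - zv) ^ (n - 2) * (1 - tv * zv ^ 2) by simp]
    refine Associated.prod _ _ _ fun i _ => ?_
    have := i.2
    by_cases h : (i : ℕ) = n - 3
    · have hM : (Matrix.of fun a b => (alexM n).submatrix f id (i, a) (i, b)) =
          -(1 - zv • tymρ n (0 + 1)) := by
        ext1 a b
        simp only [f, Matrix.of_apply, Matrix.submatrix_apply, dif_pos h, alexM_alexRow, id]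
        rw [h, alexBlock_comm_right (by omega) (by omega)]
      rw [hM, Matrix.det_neg, det_one_sub_tymρ (by omega)]
      exact associated_unit_mul_left _ _ (isUnit_one.neg.pow _)
    · refine Associated.of_eq ?_
      rw [← det_one_sub_tymρ (s := n - 2) (by omega),
        ← alexBlock_comm_left (a := i) (by omega)]
      congr 1
      ext1 a b
      simp only [f, Matrix.of_apply, Matrix.submatrix_apply, dif_neg h, alexM_alexRow, id]
  · intro i j a b hij
    have hij' : (i : ℕ) < j := hij
    have := j.2
    simp only [f, Matrix.submatrix_apply, id]
    rw [dif_neg (by omega), alexM_alexRow, alexBlock_eq_zero (by omega) (by omega),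
      Matrix.zero_apply]

theorem exists_minor_four_eq :
    ∃ f, ((alexM 4).submatrix f id).det =
      ((1 - zv) ^ 2 * (1 - tv * zv ^ 2)) *
        -((1 - zv) * (1 - tv * zv ^ 2) * (1 + tv * zv ^ 3)) := by
  let f : Fin 2 × Fin 4 → AlexRow 4 := fun r =>
    if r.1 = 0 then alexRow (a := 0) (b := 2) (by omega) (by omega) r.2
    else if r.2 = 3 then alexRow (a := 1) (b := 2) (by omega) (by omega) r.2
    else alexRow (a := 0) (b := 1) (by omega) (by omega) r.2
  refine ⟨f, ?_⟩
  rw [det_eq_prod_det_of_lower (m := 2) (n := 4), Fin.prod_univ_two]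
  · congr 1
    · rw [← det_one_sub_tymρ (n := 4) (s := 2) (by omega),
        ← alexBlock_comm_left (a := 0) (by omega)]
      rfl
    · have hM : (Matrix.of fun a b => (alexM 4).submatrix f id ((1 : Fin 2), a) ((1 : Fin 2), b)) =
          Matrix.of fun a b => if a = 3 then
            (1 - zv • tymρ 4 3 + zv ^ 2 • (tymρ 4 2 * tymρ 4 3)) a b else
            (zv • tymρ 4 1 - zv ^ 2 • (tymρ 4 2 * tymρ 4 1) - 1) a b := by
        ext1 a b
        simp only [Matrix.of_apply, Matrix.submatrix_apply]
        by_cases ha : a = 3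
        · rw [if_pos ha, ← alexBlock_braid_left (a := 1)]
          simp only [f, ha, if_true, one_ne_zero, if_false]
          rfl
        · rw [if_neg ha, ← alexBlock_braid_right (a := 0)]
          simp only [f, ha, one_ne_zero, if_false]
          rfl
      rw [hM, ← Matrix.det_transpose, det_eq_pow_mul_det_submatrix _ Fin.castSucc
        (Fin.castSucc_injective 3) 1]
      · rw [Matrix.det_fin_three]
        simp only [Matrix.submatrix_apply, Matrix.transpose_apply, Matrix.of_apply,
          braid_left_apply (n := 4) (s := 1) (by omega),
          braid_right_apply (n := 4) (s := 0) (by omega)]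
        simp [Fin.ext_iff]
        ring
      · intro p hp q
        have hp' : p = 3 := by
          by_contra h
          exact hp ⟨p.castPred h, by simp⟩
        subst hp'
        simp only [Matrix.transpose_apply, Matrix.of_apply,
          braid_left_apply (n := 4) (s := 1) (by omega),
          braid_right_apply (n := 4) (s := 0) (by omega)]
        fin_cases q <;> simp
  · intro i j a b hij
    have hi : i = 0 := by omega
    have hj : j = 1 := by omega
    subst hi hj
    change alexBlock 4 1 3 2 a b = 0
    rw [alexBlock_eq_zero (by omega) (by omega), Matrix.zero_apply]

theorem exists_minor_coprime_cyclotomic {n : ℕ} (hn : 4 ≤ n) :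
    ∃ f G, Associated ((alexM n).submatrix f id).det
      ((1 - zv) ^ (n - 2) * (1 - tv * zv ^ 2) * G) ∧
      ∀ q : Rtz, Prime q → q ∣ G → q ∣ 1 - zv ∨ q ∣ 1 - tv * zv ^ 2 ∨ q ∣ 1 + tv * zv ^ 3 := by
  rcases hn.eq_or_lt with rfl | hn
  · obtain ⟨f, hf⟩ := exists_minor_four_eq
    refine ⟨f, _, .of_eq hf, fun q hq h => ?_⟩
    rw [dvd_neg, hq.dvd_mul, hq.dvd_mul] at h
    tauto
  · obtain ⟨f, hf⟩ := exists_minor_eq_commutation hn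
    refine ⟨f, ((1 - zv) ^ (n - 2) * (1 - tv * zv ^ 2)) ^ (n - 3), ?_, fun q hq h => ?_⟩
    · rwa [← pow_succ', show n - 3 + 1 = n - 2 by omega]
    · rcases hq.dvd_or_dvd (hq.dvd_of_dvd_pow h) with h | h
      · exact .inl (hq.dvd_of_dvd_pow h)
      · exact .inr (.inl h)

theorem exists_minor_coprime_one_sub_mul_sq {n : ℕ} (hn : 4 ≤ n) :
    ∃ f G, ((alexM n).submatrix f id).det = (1 - zv) ^ (n - 2) * (1 - tv * zv ^ 2) * G ∧
      ∀ q : Rtz, Prime q → q ∣ G → q ∣ 1 - zv ∨ q ∣ 1 - zv + zv ^ 2 := by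
  let f : Fin (n - 2) × Fin n → AlexRow n := fun r =>
    if h : (r.1 : ℕ) = 0 ∨ (r.2 : ℕ) ≤ r.1 + 1 then
      alexRow (a := r.1) (b := n - 2) (by have := r.1.2; omega) (by omega) r.2
    else alexRow (a := r.1 - 1) (b := r.1) (by omega) (by have := r.1.2; omega) r.2
  let B : Fin (n - 2) → Matrix (Fin n) (Fin n) Rtz := fun i =>
    Matrix.of fun a b => (alexM n).submatrix f id (i, a) (i, b)
  let i₀ : Fin (n - 2) := ⟨0, by omega⟩
  refine ⟨f, ∏ i ∈ Finset.univ.erase i₀, (B i).det, ?_, fun q hq h => ?_⟩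
  · rw [det_eq_prod_det_of_lower, ← Finset.mul_prod_erase _ _ (Finset.mem_univ i₀)]
    · congr 1
      rw [← det_one_sub_tymρ (s := n - 2) (by omega),
        ← alexBlock_comm_left (a := 0) (by omega)]
      congr 1
    · intro i j a b hij
      have hij' : (i : ℕ) < j := hij
      have := j.2
      simp only [f, Matrix.submatrix_apply, id]
      split_ifs <;>
        rw [alexM_alexRow, alexBlock_eq_zero (by omega) (by omega), Matrix.zero_apply]
  · obtain ⟨i, hi, h⟩ := (hq.dvd_finsetProd_iff _).1 h
    have hi0 : (i : ℕ) ≠ 0 := fun h => (Finset.mem_erase.1 hi).1 (Fin.ext h)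
    have hi2 := i.2
    have hupper : ∀ a b : Fin n, (a : ℕ) ≤ i + 1 → (i : ℕ) < n - 3 →
        B i a b = if a = b then 1 - zv else 0 := by
      intro a b ha hi'
      simp only [B, f, Matrix.of_apply, Matrix.submatrix_apply, id, dif_pos (Or.inr ha)]
      rw [alexM_alexRow, alexBlock_comm_left (by omega), one_sub_tymρ_apply, if_neg (by omega),
        if_neg (by omega)]
      simp only [Fin.ext_iff]
    have hlast : ∀ a b : Fin n, (a : ℕ) ≤ i + 1 → (i : ℕ) = n - 3 →
        B i a b = (1 - zv • tymρ n (i + 2) + zv ^ 2 • (tymρ n (i + 1) * tymρ n (i + 2))) a b := by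
      intro a b ha hi'
      simp only [B, f, Matrix.of_apply, Matrix.submatrix_apply, id, dif_pos (Or.inr ha)]
      rw [alexM_alexRow, ← alexBlock_braid_left, show n - 2 + 1 = (i : ℕ) + 2 by omega]
    have hlower : ∀ a b : Fin n, (i : ℕ) + 1 < a →
        B i a b = if a = b then -(1 - zv + zv ^ 2) else 0 := by
      intro a b ha
      simp only [B, f, Matrix.of_apply, Matrix.submatrix_apply, id]
      rw [dif_neg (by omega), alexM_alexRow, show (i : ℕ) + 1 = (i - 1 : ℕ) + 2 by omega,
        alexBlock_braid_right, braid_right_apply (by omega), if_neg (by omega), if_neg (by omega),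
        if_neg (by omega)]
      simp only [Fin.ext_iff]
    have hdiag : ∀ a : Fin n, a ∉ Set.range ![(⟨i, by omega⟩ : Fin n), ⟨i + 1, by omega⟩] →
        ∃ c : Rtz, (q ∣ c → q ∣ 1 - zv ∨ q ∣ 1 - zv + zv ^ 2) ∧
          ∀ b, B i a b = if a = b then c else 0 := by
      intro a ha
      have h1 : (a : ℕ) ≠ i := fun h => ha ⟨0, Fin.ext h.symm⟩
      have h2 : (a : ℕ) ≠ i + 1 := fun h => ha ⟨1, Fin.ext h.symm⟩
      by_cases ha' : (i : ℕ) + 1 < a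
      · exact ⟨_, fun h => .inr (dvd_neg.1 h), fun b => hlower a b ha'⟩
      · by_cases hi' : (i : ℕ) = n - 3
        · refine ⟨_, fun h => .inr h, fun b => ?_⟩
          rw [hlast a b (by omega) hi', braid_left_apply (by omega), if_neg h1, if_neg h2,
            if_neg (by omega)]
          simp only [Fin.ext_iff]
        · exact ⟨_, fun h => .inl h, fun b => hupper a b (by omega) (by omega)⟩
    rw [det_eq_prod_mul_det_submatrix (B i) ![⟨i, by omega⟩, ⟨i + 1, by omega⟩]
      (fun j k => by fin_cases j <;> fin_cases k <;> simp)
      (fun a ha b hb => by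
        obtain ⟨c, -, hc⟩ := hdiag a ha
        rw [hc, if_neg hb.symm]), hq.dvd_mul] at h
    rcases h with h | h
    · obtain ⟨a, -, ha⟩ := (hq.dvd_finsetProd_iff _).1 h
      obtain ⟨c, hc, hc'⟩ := hdiag a.1 a.2
      rw [hc', if_pos rfl] at ha
      exact hc ha
    · rw [Matrix.det_fin_two] at h
      left
      simp only [Matrix.submatrix_apply, Matrix.cons_val_zero, Matrix.cons_val_one] at h
      by_cases hi' : (i : ℕ) = n - 3
      · rw [hlast _ _ (by simp) hi', hlast _ _ (by simp) hi', hlast _ _ (by simp) hi',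
          hlast _ _ (by simp) hi'] at h
        simp only [braid_left_apply (show (i : ℕ) + 2 < n by omega)] at h
        simpa using h
      · rw [hupper _ _ (by simp) (by omega), hupper _ _ (by simp) (by omega),
          hupper _ _ (by simp) (by omega), hupper _ _ (by simp) (by omega)] at h
        have h' : q ∣ (1 - zv) * (1 - zv) := by simpa using h
        exact (hq.dvd_or_dvd h').elim id id

theorem dvd_of_dvd_mul_of_forall_prime {S : Type*} [CommRing S] [IsDomain S]
    [UniqueFactorizationMonoid S] {p D a b c : S} (ha : a ≠ 0)
    (h : ∀ q, Prime q → q ∣ a → q ∣ b → ¬q ∣ c)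
    (hpa : p ∣ D * a) (hpb : p ∣ D * b) (hpc : p ∣ D * c) : p ∣ D := by
  let : GCDMonoid S := UniqueFactorizationMonoid.toGCDMonoid S
  have hunit : IsUnit (gcd a (gcd b c)) := by
    by_contra hu
    obtain ⟨q, hq, hqd⟩ := WfDvdMonoid.exists_irreducible_factor hu
      (ne_zero_of_dvd_ne_zero ha (gcd_dvd_left _ _))
    exact h q hq.prime (hqd.trans (gcd_dvd_left _ _))
      (hqd.trans ((gcd_dvd_right _ _).trans (gcd_dvd_left _ _)))
      (hqd.trans ((gcd_dvd_right _ _).trans (gcd_dvd_right _ _)))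
  have hdvd : p ∣ D * gcd a (gcd b c) :=
    (dvd_gcd hpa ((dvd_gcd hpb hpc).trans (gcd_mul_left' _ _ _).dvd)).trans
      (gcd_mul_left' _ _ _).dvd
  exact hunit.dvd_mul_right.1 hdvd

theorem not_dvd_of_prime_dvd_one_add {q g : Rtz} (hq : Prime q) (hg : q ∣ 1 + tv * g) :
    ¬q ∣ 1 - zv ∧ ¬q ∣ 1 - zv + zv ^ 2 :=
  ⟨fun h => hq.not_isUnit (isUnit_of_dvd_one_sub_of_dvd h hg),
    fun h => hq.not_isUnit (isUnit_of_dvd_cyclotomic_of_dvd h hg)⟩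

theorem no_common_prime_factor {q : Rtz} (hq : Prime q)
    (h₁ : q ∣ 1 - zv + zv ^ 2 ∨ q ∣ 1 - tv * zv ^ 2 ∨ q ∣ 1 + tv * zv ^ 3)
    (h₂ : q ∣ 1 - zv ∨ q ∣ 1 - zv + zv ^ 2)
    (h₃ : q ∣ 1 - zv ∨ q ∣ 1 - tv * zv ^ 2 ∨ q ∣ 1 + tv * zv ^ 3) : False := by
  have hsq : q ∣ 1 - tv * zv ^ 2 → ¬q ∣ 1 - zv ∧ ¬q ∣ 1 - zv + zv ^ 2 := fun h =>
    not_dvd_of_prime_dvd_one_add (g := -zv ^ 2) hq (by convert h using 1; ring)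
  have hcube : q ∣ 1 + tv * zv ^ 3 → ¬q ∣ 1 - zv ∧ ¬q ∣ 1 - zv + zv ^ 2 :=
    not_dvd_of_prime_dvd_one_add hq
  have hcop : q ∣ 1 - zv → ¬q ∣ 1 - zv + zv ^ 2 := by
    intro h h'
    refine hq.not_isUnit (isUnit_of_dvd_one ?_)
    convert h'.add (h.mul_left zv) using 1
    ring
  generalize (q ∣ 1 - zv) = P₁ at *
  generalize (q ∣ 1 - zv + zv ^ 2) = P₂ at *
  generalize (q ∣ 1 - tv * zv ^ 2) = P₃ at *
  generalize (q ∣ 1 + tv * zv ^ 3) = P₄ at *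
  tauto

theorem dvd_of_forall_dvd_minor {n : ℕ} (hn : 4 ≤ n) {p : Rtz}
    (hp : ∀ f : Fin (n - 2) × Fin n → AlexRow n, Function.Injective f →
      p ∣ ((alexM n).submatrix f id).det) :
    p ∣ (1 - zv) ^ (n - 2) * (1 - tv * zv ^ 2) := by
  have hp' : ∀ f : Fin (n - 2) × Fin n → AlexRow n, p ∣ ((alexM n).submatrix f id).det := by
    intro f
    by_cases hf : Function.Injective f
    · exact hp f hf
    · obtain ⟨r, s, hrs, hne⟩ : ∃ r s, f r = f s ∧ r ≠ s := by
        simpa [Function.Injective] using hf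
      rw [Matrix.det_zero_of_row_eq hne (by ext c; simp [hrs])]
      exact dvd_zero p
  obtain ⟨f₁, h₁⟩ := exists_minor_eq_braid hn
  obtain ⟨f₂, G₂, h₂, hG₂⟩ := exists_minor_coprime_one_sub_mul_sq hn
  obtain ⟨f₃, G₃, h₃, hG₃⟩ := exists_minor_coprime_cyclotomic hn
  set D := (1 - zv) ^ (n - 2) * (1 - tv * zv ^ 2) with hD
  set G₁ : Rtz := (1 - zv + zv ^ 2) ^ ((n - 3) * (n - 2)) * (1 - tv * zv ^ 2) ^ (n - 3) *
    (1 + tv * zv ^ 3) ^ (n - 2) with hG₁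
  have d₁ : p ∣ D * G₁ := by
    convert hp' f₁ using 1
    rw [h₁, hD, hG₁, mul_pow, mul_pow, mul_pow, ← pow_mul,
      show (1 - tv * zv ^ 2) ^ (n - 2) = (1 - tv * zv ^ 2) * (1 - tv * zv ^ 2) ^ (n - 3) by
        rw [← pow_succ', show n - 3 + 1 = n - 2 by omega]]
    ring
  have d₂ : p ∣ D * G₂ := h₂ ▸ hp' f₂
  have d₃ : p ∣ D * G₃ := h₃.dvd_iff_dvd_right.1 (hp' f₃)
  refine dvd_of_dvd_mul_of_forall_prime (fun h => ?_) (fun q hq q₁ q₂ q₃ => ?_) d₁ d₂ d₃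
  · simpa [hG₁, tv, zv] using congrArg (MvPolynomial.eval fun _ => (0 : ℤ)) h
  · refine no_common_prime_factor hq ?_ (hG₂ q hq q₂) (hG₃ q hq q₃)
    rw [hG₁, hq.dvd_mul, hq.dvd_mul] at q₁
    rcases q₁ with (h | h) | h
    · exact .inl (hq.dvd_of_dvd_pow h)
    · exact .inr (.inl (hq.dvd_of_dvd_pow h))
    · exact .inr (.inr (hq.dvd_of_dvd_pow h))

/-- For `n ≥ 4`, the polynomial `(1-z)^{n-2}·(1-tz²)` is a greatest common divisor of the
family of all maximal minors of the Alexander matrix `M_{n-1}`: it divides every maximal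
minor, and every common divisor of all the maximal minors divides it. Consequently, since
`det Φ(1-σ_{n-1}) = det(I_n - z·ρ_{n-1})` equals this same polynomial, the twisted Alexander
invariant of `B_n` (`n ≥ 4`) associated with the Tong–Yang–Ma representation equals `1`. -/
theorem gcd_of_maximal_minors_and_twisted_alexander_trivial (n : ℕ) (hn : 4 ≤ n) :
    (∀ f : Fin (n - 2) × Fin n → AlexRow n, Function.Injective f →
      (1 - zv) ^ (n - 2) * (1 - tv * zv ^ 2) ∣ ((alexM n).submatrix f id).det) ∧
    (∀ p : Rtz,
      (∀ f : Fin (n - 2) × Fin n → AlexRow n, Function.Injective f →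
        p ∣ ((alexM n).submatrix f id).det) →
      p ∣ (1 - zv) ^ (n - 2) * (1 - tv * zv ^ 2)) ∧
    (1 - zv) ^ (n - 2) * (1 - tv * zv ^ 2) = (1 - zv • tymρ n (n - 1)).det := by
  refine ⟨fun f _ => mul_dvd_minor hn f, fun p hp => dvd_of_forall_dvd_minor hn hp, ?_⟩
  rw [show n - 1 = n - 2 + 1 by omega, det_one_sub_tymρ (by omega)]
end
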